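/- arXiv:2301.05964 — 5 statements merged into one kernel-verified Lean document; each statement's English description precedes it below -/
import Mathlib

section
/- Let C₀ > 0 and M > 0, let g : ℝ → ℝ be an even measurable function with |g| ≤ M and g(x) = 0 for |x| > C₀, let ω : ℝ → ℝ be a nonnegative, even, integrable function with ∫_ℝ ω(t) dt = 1 whose cosine transform ŵ(ξ) := ∫_ℝ ω(t) cos(tξ) dt vanishes outside [−1,1], and set U_T(x,y) := (1/2)ŵ(T(x−y)) + (1/2)ŵ(T(x+y)) − ŵ(Tx)·ŵ(Ty). Then there is a constant C > 0, depending only on C₀ and M, such that for all integers k₁, k₂ ≥ 1 and all reals T ≥ 1, L ≥ 1: (1/L²) ∫₀^∞ ∫₀^∞ |g(k₁x/L)| · |g(k₂y/L)| · [sinh²(x/2) sinh²(y/2) / (sinh(k₁x/2) sinh(k₂y/2))] · |U_T(k₁x, k₂y)| dx dy ≤ C · e^{2C₀L} / (T L k₁² k₂²). -/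
open MeasureTheory

/-- A nonnegative function on `(0, ∞)` dominated by `K` on `[a, b]` and vanishing elsewhere has
integral at most `K * (b - a)`. No measurability is needed. -/
lemma setIntegral_Ioi_le_of_le_indicator_Icc {f : ℝ → ℝ} {a b K : ℝ} (hab : a ≤ b) (hK : 0 ≤ K)
    (hf : ∀ x, 0 < x → 0 ≤ f x)
    (hfK : ∀ x, 0 < x → f x ≤ (Set.Icc a b).indicator (fun _ => K) x) :
    ∫ x in Set.Ioi (0 : ℝ), f x ≤ K * (b - a) := by
  have hint : Integrable ((Set.Icc a b).indicator (fun _ : ℝ => K)) :=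
    (integrable_indicator_iff measurableSet_Icc).2 (integrableOn_const (by simp))
  calc ∫ x in Set.Ioi (0 : ℝ), f x
      ≤ ∫ x in Set.Ioi (0 : ℝ), (Set.Icc a b).indicator (fun _ => K) x :=
        integral_mono_of_nonneg
          ((ae_restrict_iff' measurableSet_Ioi).2 (.of_forall hf)) hint.integrableOn
          ((ae_restrict_iff' measurableSet_Ioi).2 (.of_forall hfK))
    _ ≤ ∫ x, (Set.Icc a b).indicator (fun _ => K) x :=
        setIntegral_le_integral hint
          (.of_forall fun x => Set.indicator_nonneg (fun _ _ => hK) x)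
    _ = K * (b - a) := by
        rw [integral_indicator measurableSet_Icc, setIntegral_const, Real.volume_real_Icc_of_le hab,
          smul_eq_mul, mul_comm]

lemma nat_mul_sinh_le_sinh_nat_mul (k : ℕ) {t : ℝ} (ht : 0 ≤ t) :
    k * Real.sinh t ≤ Real.sinh (k * t) := by
  induction k with
  | zero => simp
  | succ k ih =>
    have h₁ : 0 ≤ Real.sinh t := Real.sinh_nonneg_iff.2 ht
    have h₂ : 0 ≤ Real.sinh (k * t) := Real.sinh_nonneg_iff.2 (by positivity)
    push_cast
    rw [add_mul, add_mul, one_mul, one_mul, Real.sinh_add]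
    nlinarith [mul_le_mul_of_nonneg_left (Real.one_le_cosh t) h₂,
      mul_le_mul_of_nonneg_right (Real.one_le_cosh (k * t)) h₁]

lemma sinh_sq_div_sinh_nat_mul_le {k : ℕ} (hk : 1 ≤ k) {x A : ℝ} (hx : 0 < x)
    (hA : k * x ≤ A) :
    Real.sinh (x / 2) ^ 2 / Real.sinh (k * x / 2) ≤ Real.exp (A / 2) / (k : ℝ) ^ 2 := by
  have hk' : (0 : ℝ) < k := by exact_mod_cast hk
  have hmul := nat_mul_sinh_le_sinh_nat_mul k (half_pos hx).le
  rw [← mul_div_assoc] at hmul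
  have hpos : 0 < Real.sinh (k * x / 2) := Real.sinh_pos_iff.2 (by positivity)
  have hsq : (k * Real.sinh (x / 2)) ^ 2 ≤ Real.sinh (k * x / 2) ^ 2 :=
    pow_le_pow_left₀ (mul_nonneg hk'.le (Real.sinh_nonneg_iff.2 (half_pos hx).le)) hmul 2
  have hexp : Real.sinh (k * x / 2) ≤ Real.exp (A / 2) :=
    calc Real.sinh (k * x / 2) ≤ Real.exp (k * x / 2) := by
          rw [Real.sinh_eq]
          linarith [Real.exp_pos (k * x / 2), Real.exp_pos (-(k * x / 2))]
      _ ≤ Real.exp (A / 2) := Real.exp_le_exp.2 (by linarith)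
  rw [div_le_div_iff₀ hpos (by positivity)]
  nlinarith

lemma abs_integral_mul_cos_le {ω : ℝ → ℝ} (hω : ∀ t, 0 ≤ ω t) (hint : Integrable ω) (ξ : ℝ) :
    |∫ t, ω t * Real.cos (t * ξ)| ≤ ∫ t, ω t := by
  refine norm_integral_le_of_norm_le (f := fun t => ω t * Real.cos (t * ξ)) hint
    (.of_forall fun t => ?_)
  rw [Real.norm_eq_abs, abs_mul, abs_of_nonneg (hω t)]
  exact mul_le_of_le_one_right (hω t) (Real.abs_cos_le_one _)

lemma abs_kernel_le_two {w : ℝ → ℝ} (hw : ∀ ξ, |w ξ| ≤ 1) (a b c d : ℝ) :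
    |(1 / 2) * w a + (1 / 2) * w b - w c * w d| ≤ 2 := by
  have hcd : |w c * w d| ≤ 1 := by
    rw [abs_mul]
    exact mul_le_one₀ (hw c) (abs_nonneg _) (hw d)
  have ha := abs_le.1 (hw a)
  have hb := abs_le.1 (hw b)
  have hcd' := abs_le.1 hcd
  rw [abs_le]
  constructor <;> linarith

lemma kernel_eq_zero {w : ℝ → ℝ} (hw : ∀ ξ, 1 < |ξ| → w ξ = 0) {T u v : ℝ} (hT : 0 < T)
    (hu : 0 < u) (hv : 0 < v) (huv : 1 < T * |u - v|) :
    (1 / 2) * w (T * (u - v)) + (1 / 2) * w (T * (u + v)) - w (T * u) * w (T * v) = 0 := by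
  have hsub : w (T * (u - v)) = 0 := hw _ (by rwa [abs_mul, abs_of_pos hT])
  have hadd : w (T * (u + v)) = 0 := by
    refine hw _ (huv.trans_le ?_)
    rw [abs_mul, abs_of_pos hT, abs_of_pos (add_pos hu hv)]
    exact mul_le_mul_of_nonneg_left (abs_le.2 ⟨by linarith, by linarith⟩) hT.le
  have hmul : w (T * u) * w (T * v) = 0 := by
    rcases le_total v u with h | h
    · rw [hw (T * u), zero_mul]
      refine huv.trans_le ?_
      rw [abs_mul, abs_of_pos hT, abs_of_pos hu]
      exact mul_le_mul_of_nonneg_left (abs_le.2 ⟨by linarith, by linarith⟩) hT.le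
    · rw [hw (T * v), mul_zero]
      refine huv.trans_le ?_
      rw [abs_mul, abs_of_pos hT, abs_of_pos hv]
      exact mul_le_mul_of_nonneg_left (abs_le.2 ⟨by linarith, by linarith⟩) hT.le
  rw [hsub, hadd, hmul]
  norm_num

/-- single-term off-diagonal bound. There is `C > 0` depending only on `C₀, M`
such that for every even measurable `g` with `|g| ≤ M` supported in `[−C₀, C₀]`, every
nonnegative even integrable weight `ω` with `∫ ω = 1` whose cosine transform `w` is
supported in `[−1,1]`, all integers `k₁, k₂ ≥ 1` and reals `T, L ≥ 1`:
`(1/L²) ∫₀^∞∫₀^∞ |g(k₁x/L)||g(k₂y/L)| · sinh²(x/2)sinh²(y/2)/(sinh(k₁x/2)sinh(k₂y/2))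
 · |U_T(k₁x,k₂y)| dy dx ≤ C e^{2C₀L}/(T L k₁² k₂²)`. -/
theorem stmt_3 (C₀ M : ℝ) (hC₀ : 0 < C₀) (hM : 0 < M) :
    ∃ C : ℝ, 0 < C ∧
      ∀ (g ω w : ℝ → ℝ),
        Measurable g → (∀ x, g (-x) = g x) → (∀ x, |g x| ≤ M) →
        (∀ x, C₀ < |x| → g x = 0) →
        (∀ t, 0 ≤ ω t) → (∀ t, ω (-t) = ω t) → Integrable ω → (∫ t : ℝ, ω t = 1) →
        (∀ ξ : ℝ, w ξ = ∫ t : ℝ, ω t * Real.cos (t * ξ)) →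
        (∀ ξ : ℝ, 1 < |ξ| → w ξ = 0) →
        ∀ (U : ℝ → ℝ → ℝ → ℝ),
          (∀ T x y : ℝ, U T x y =
            (1 / 2) * w (T * (x - y)) + (1 / 2) * w (T * (x + y)) - w (T * x) * w (T * y)) →
        ∀ (k₁ k₂ : ℕ), 1 ≤ k₁ → 1 ≤ k₂ → ∀ (T L : ℝ), 1 ≤ T → 1 ≤ L →
        (1 / L ^ 2) * (∫ x in Set.Ioi (0 : ℝ), ∫ y in Set.Ioi (0 : ℝ),
            |g ((k₁ : ℝ) * x / L)| * |g ((k₂ : ℝ) * y / L)| *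
            (Real.sinh (x / 2) ^ 2 * Real.sinh (y / 2) ^ 2 /
              (Real.sinh ((k₁ : ℝ) * x / 2) * Real.sinh ((k₂ : ℝ) * y / 2))) *
            |U T ((k₁ : ℝ) * x) ((k₂ : ℝ) * y)|)
          ≤ C * Real.exp (2 * C₀ * L) / (T * L * (k₁ : ℝ) ^ 2 * (k₂ : ℝ) ^ 2) := by
  refine ⟨4 * C₀ * M ^ 2, by positivity, ?_⟩
  intro g ω w _ _ hgM hg hω _ hωint hω1 hw hwsupp U hU k₁ k₂ hk₁ hk₂ T L hT hL
  have hT0 : 0 < T := by linarith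
  have hL0 : 0 < L := by linarith
  have hk₁0 : (1 : ℝ) ≤ k₁ := by exact_mod_cast hk₁
  have hk₂0 : (1 : ℝ) ≤ k₂ := by exact_mod_cast hk₂
  have hw1 : ∀ ξ, |w ξ| ≤ 1 := fun ξ => by
    rw [hw ξ, ← hω1]
    exact abs_integral_mul_cos_le hω hωint ξ
  have hgzero : ∀ {k : ℕ} {x : ℝ}, 0 < x → C₀ * L < k * x → g (k * x / L) = 0 := by
    intro k x hx h
    apply hg
    rwa [abs_of_nonneg (by positivity), lt_div_iff₀ hL0]
  set F : ℝ → ℝ → ℝ := fun x y =>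
    |g ((k₁ : ℝ) * x / L)| * |g ((k₂ : ℝ) * y / L)| *
      (Real.sinh (x / 2) ^ 2 * Real.sinh (y / 2) ^ 2 /
        (Real.sinh ((k₁ : ℝ) * x / 2) * Real.sinh ((k₂ : ℝ) * y / 2))) *
      |U T ((k₁ : ℝ) * x) ((k₂ : ℝ) * y)| with hF
  set K : ℝ := 2 * M ^ 2 * Real.exp (C₀ * L) / ((k₁ : ℝ) ^ 2 * (k₂ : ℝ) ^ 2) with hKdef
  have hK : 0 ≤ K := by positivity
  have hsinh : ∀ {k : ℕ} {x : ℝ}, 0 < x → 0 ≤ Real.sinh (k * x / 2) := fun hx =>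
    Real.sinh_nonneg_iff.2 (by positivity)
  have hFnonneg : ∀ x, 0 < x → ∀ y, 0 < y → 0 ≤ F x y := fun x hx y hy => by
    have := hsinh (k := k₁) hx
    have := hsinh (k := k₂) hy
    positivity
  have hFle : ∀ x, 0 < x → ∀ y, 0 < y → F x y ≤ K := by
    intro x hx y hy
    by_cases hxL : C₀ * L < k₁ * x
    · simpa [hF, hgzero hx hxL] using hK
    by_cases hyL : C₀ * L < k₂ * y
    · simpa [hF, hgzero hy hyL] using hK
    have hx' := sinh_sq_div_sinh_nat_mul_le hk₁ hx (not_lt.1 hxL)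
    have hy' := sinh_sq_div_sinh_nat_mul_le hk₂ hy (not_lt.1 hyL)
    have hU2 : |U T (k₁ * x) (k₂ * y)| ≤ 2 := by
      rw [hU]
      exact abs_kernel_le_two hw1 _ _ _ _
    have hsx := hsinh (k := k₁) hx
    have hsy := hsinh (k := k₂) hy
    have hexp : Real.exp (C₀ * L) = Real.exp (C₀ * L / 2) * Real.exp (C₀ * L / 2) := by
      rw [← Real.exp_add, add_halves]
    calc F x y ≤ M * M * (Real.exp (C₀ * L / 2) / (k₁ : ℝ) ^ 2 *
          (Real.exp (C₀ * L / 2) / (k₂ : ℝ) ^ 2)) * 2 := by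
          simp only [hF, mul_div_mul_comm]
          gcongr
          · exact hgM _
          · exact hgM _
      _ = K := by
          rw [hKdef, hexp]
          ring
  have hFzero : ∀ x, 0 < x → ∀ y, 0 < y →
      y ∉ Set.Icc ((k₁ * x - 1 / T) / k₂) ((k₁ * x + 1 / T) / k₂) → F x y = 0 := by
    intro x hx y hy hmem
    have hlt : 1 < T * |k₁ * x - k₂ * y| := by
      by_contra! h
      rw [← le_div_iff₀' hT0, abs_le] at h
      refine hmem ⟨?_, ?_⟩
      · rw [div_le_iff₀ (by positivity)]
        linarith [h.2]
      · rw [le_div_iff₀ (by positivity)]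
        linarith [h.1]
    have hU0 : U T (k₁ * x) (k₂ * y) = 0 := by
      rw [hU]
      exact kernel_eq_zero hwsupp hT0 (by positivity) (by positivity) hlt
    simp [hF, hU0]
  have hinner : ∀ x, 0 < x → ∫ y in Set.Ioi (0 : ℝ), F x y ≤ K * (2 / T) := by
    intro x hx
    have hT' : 0 < 1 / T := by positivity
    refine (setIntegral_Ioi_le_of_le_indicator_Icc (a := (k₁ * x - 1 / T) / k₂)
      (b := (k₁ * x + 1 / T) / k₂) ?_ hK (hFnonneg x hx) fun y hy => ?_).trans ?_
    · gcongr
      linarith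
    · by_cases hmem : y ∈ Set.Icc ((k₁ * x - 1 / T) / k₂) ((k₁ * x + 1 / T) / k₂)
      · rw [Set.indicator_of_mem hmem]
        exact hFle x hx y hy
      · rw [Set.indicator_of_notMem hmem, hFzero x hx y hy hmem]
    · rw [← sub_div]
      refine mul_le_mul_of_nonneg_left ((div_le_self ?_ hk₂0).trans_eq (by ring)) hK
      linarith
  have houter : ∫ x in Set.Ioi (0 : ℝ), ∫ y in Set.Ioi (0 : ℝ), F x y ≤
      K * (2 / T) * (C₀ * L - 0) := by
    refine setIntegral_Ioi_le_of_le_indicator_Icc (by positivity) (by positivity)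
      (fun x hx => setIntegral_nonneg measurableSet_Ioi (hFnonneg x hx)) fun x hx => ?_
    by_cases hmem : x ∈ Set.Icc 0 (C₀ * L)
    · rw [Set.indicator_of_mem hmem]
      exact hinner x hx
    · have hxL : C₀ * L < k₁ * x := by
        have : C₀ * L < x := by
          by_contra! h
          exact hmem ⟨hx.le, h⟩
        nlinarith
      simp [Set.indicator_of_notMem hmem, hF, hgzero hx hxL]
  calc (1 / L ^ 2) * (∫ x in Set.Ioi (0 : ℝ), ∫ y in Set.Ioi (0 : ℝ), F x y)
      ≤ (1 / L ^ 2) * (K * (2 / T) * (C₀ * L - 0)) := by gcongr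
    _ = 4 * C₀ * M ^ 2 * Real.exp (C₀ * L) / (T * L * (k₁ : ℝ) ^ 2 * (k₂ : ℝ) ^ 2) := by
        rw [hKdef]
        field_simp
        ring
    _ ≤ 4 * C₀ * M ^ 2 * Real.exp (2 * C₀ * L) / (T * L * (k₁ : ℝ) ^ 2 * (k₂ : ℝ) ^ 2) := by
        gcongr
        nlinarith
end

section
/- There exists an absolute constant C > 0 such that for all integers k₁, k₂ with 1 ≤ k₁ ≤ k₂ and k₁ + k₂ ≥ 3, one has ∫₀^∞ x · sinh²(x/2) / (sinh(k₁x/2) · sinh(k₂x/2)) dx ≤ C · min( 1/(k₁ + k₂ − 2)² , 1/(k₁ k₂³) ). -/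
open MeasureTheory Set

lemma mul_sinh_le_sinh_mul {c t : ℝ} (hc : 1 ≤ c) (ht : 0 ≤ t) :
    c * Real.sinh t ≤ Real.sinh (c * t) := by
  have hderiv (s : ℝ) : HasDerivAt (fun s => Real.sinh (c * s) - c * Real.sinh s)
      (Real.cosh (c * s) * (c * 1) - c * Real.cosh s) s :=
    (((hasDerivAt_id s).const_mul c).sinh).sub ((Real.hasDerivAt_sinh s).const_mul c)
  have hmono : MonotoneOn (fun s => Real.sinh (c * s) - c * Real.sinh s) (Ici 0) := by
    refine monotoneOn_of_deriv_nonneg (convex_Ici 0)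
      (fun s _ => (hderiv s).continuousAt.continuousWithinAt)
      (fun s _ => (hderiv s).differentiableAt.differentiableWithinAt) fun s hs => ?_
    rw [interior_Ici] at hs
    have hs0 : 0 ≤ s := le_of_lt hs
    have hcosh : Real.cosh s ≤ Real.cosh (c * s) := by
      rw [Real.cosh_le_cosh, abs_of_nonneg hs0, abs_of_nonneg (by positivity)]
      nlinarith
    rw [(hderiv s).deriv]
    nlinarith
  have h := hmono self_mem_Ici ht ht
  simp only [mul_zero, Real.sinh_zero, sub_zero] at h
  linarith

lemma mul_sinh_mul_exp_le_sinh_mul {c t : ℝ} (hc : 2 ≤ c) (ht : 0 ≤ t) :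
    c / 2 * Real.sinh t * Real.exp (c * t / 2) ≤ Real.sinh (c * t) := by
  have hsinh := mul_sinh_le_sinh_mul (c := c / 2) (by linarith) ht
  have hcosh : Real.exp (c * t / 2) ≤ 2 * Real.cosh (c / 2 * t) := by
    rw [Real.cosh_eq, show c * t / 2 = c / 2 * t by ring]
    linarith [Real.exp_pos (-(c / 2 * t))]
  have hpos : 0 ≤ Real.sinh t := Real.sinh_nonneg_iff.2 ht
  calc c / 2 * Real.sinh t * Real.exp (c * t / 2)
      ≤ Real.sinh (c / 2 * t) * (2 * Real.cosh (c / 2 * t)) :=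
        mul_le_mul hsinh hcosh (Real.exp_pos _).le
          (Real.sinh_nonneg_iff.2 (by positivity))
    _ = Real.sinh (c * t) := by
        rw [show c * t = 2 * (c / 2 * t) by ring, Real.sinh_two_mul]
        ring

lemma mul_sinh_sq_div_le {a b x : ℝ} (ha : 1 ≤ a) (hb : 2 ≤ b) (hx : 0 < x) :
    x * Real.sinh (x / 2) ^ 2 / (Real.sinh (a * x / 2) * Real.sinh (b * x / 2)) ≤
      2 / (a * b) * (x * Real.exp (-(b / 4 * x))) := by
  have hs : 0 < Real.sinh (x / 2) := Real.sinh_pos_iff.2 (by positivity)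
  have h1 := mul_sinh_le_sinh_mul ha (half_pos hx).le
  have h2 := mul_sinh_mul_exp_le_sinh_mul hb (half_pos hx).le
  rw [← mul_div_assoc] at h1 h2
  calc x * Real.sinh (x / 2) ^ 2 / (Real.sinh (a * x / 2) * Real.sinh (b * x / 2))
      ≤ x * Real.sinh (x / 2) ^ 2 / (a * Real.sinh (x / 2) *
          (b / 2 * Real.sinh (x / 2) * Real.exp (b * x / 2 / 2))) := by gcongr
    _ = 2 / (a * b) * (x * Real.exp (-(b / 4 * x))) := by
        rw [Real.exp_neg, show b * x / 2 / 2 = b / 4 * x by ring]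
        field_simp

lemma integral_mul_exp_neg_mul_Ioi {r : ℝ} (hr : 0 < r) :
    ∫ x in Ioi (0 : ℝ), x * Real.exp (-(r * x)) = (1 / r) ^ 2 := by
  have h := Real.integral_rpow_mul_exp_neg_mul_Ioi (a := 2) two_pos hr
  norm_num [Real.Gamma_two] at h
  simpa using h

lemma integrableOn_mul_exp_neg_mul_Ioi {r : ℝ} (hr : 0 < r) :
    IntegrableOn (fun x => x * Real.exp (-(r * x))) (Ioi 0) := by
  refine Integrable.of_integral_ne_zero ?_
  rw [integral_mul_exp_neg_mul_Ioi hr]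
  positivity

lemma integral_mul_sinh_sq_div_le {a b : ℝ} (ha : 1 ≤ a) (hb : 2 ≤ b) :
    ∫ x in Ioi (0 : ℝ),
        x * Real.sinh (x / 2) ^ 2 / (Real.sinh (a * x / 2) * Real.sinh (b * x / 2)) ≤
      32 / (a * b ^ 3) := by
  have hb4 : 0 < b / 4 := by positivity
  calc ∫ x in Ioi (0 : ℝ),
        x * Real.sinh (x / 2) ^ 2 / (Real.sinh (a * x / 2) * Real.sinh (b * x / 2))
      ≤ ∫ x in Ioi (0 : ℝ), 2 / (a * b) * (x * Real.exp (-(b / 4 * x))) := by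
        refine integral_mono_of_nonneg ?_ ((integrableOn_mul_exp_neg_mul_Ioi hb4).const_mul _) ?_
        · filter_upwards [ae_restrict_mem measurableSet_Ioi] with x hx
          have hx0 : 0 < x := hx
          have h1 : 0 < Real.sinh (a * x / 2) := Real.sinh_pos_iff.2 (by positivity)
          have h2 : 0 < Real.sinh (b * x / 2) := Real.sinh_pos_iff.2 (by positivity)
          simp only [Pi.zero_apply]
          positivity
        · filter_upwards [ae_restrict_mem measurableSet_Ioi] with x hx
          exact mul_sinh_sq_div_le ha hb hx
    _ = 32 / (a * b ^ 3) := by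
        rw [integral_const_mul, integral_mul_exp_neg_mul_Ioi hb4]
        field_simp
        norm_num

/-- There is an absolute constant `C > 0` such that for all integers
`1 ≤ k₁ ≤ k₂` with `k₁ + k₂ ≥ 3`,
`∫₀^∞ x sinh²(x/2)/(sinh(k₁x/2) sinh(k₂x/2)) dx ≤ C min(1/(k₁+k₂−2)², 1/(k₁k₂³))`. -/
theorem stmt_5 :
    ∃ C : ℝ, 0 < C ∧
      ∀ (k₁ k₂ : ℕ), 1 ≤ k₁ → k₁ ≤ k₂ → 3 ≤ k₁ + k₂ →
        (∫ x in Set.Ioi (0 : ℝ),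
            x * Real.sinh (x / 2) ^ 2 /
              (Real.sinh ((k₁ : ℝ) * x / 2) * Real.sinh ((k₂ : ℝ) * x / 2)))
          ≤ C * min (1 / ((k₁ : ℝ) + (k₂ : ℝ) - 2) ^ 2) (1 / ((k₁ : ℝ) * (k₂ : ℝ) ^ 3)) := by
  refine ⟨128, by norm_num, fun k₁ k₂ h1 h12 h3 => ?_⟩
  have ha : (1 : ℝ) ≤ k₁ := by exact_mod_cast h1
  have hab : (k₁ : ℝ) ≤ k₂ := by exact_mod_cast h12
  have hb : (2 : ℝ) ≤ k₂ := by exact_mod_cast (by omega : 2 ≤ k₂)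
  have hsum : (3 : ℝ) ≤ k₁ + k₂ := by exact_mod_cast h3
  refine (integral_mul_sinh_sq_div_le ha hb).trans ?_
  rw [mul_min_of_nonneg _ _ (by norm_num : (0 : ℝ) ≤ 128), mul_one_div, mul_one_div]
  generalize (k₁ : ℝ) = a at *
  generalize (k₂ : ℝ) = b at *
  refine le_min ?_ (by gcongr; norm_num)
  have hsq : (a + b - 2) ^ 2 ≤ (2 * b) ^ 2 := pow_le_pow_left₀ (by linarith) (by linarith) 2
  have hcube : b ^ 2 ≤ a * b ^ 3 := by
    nlinarith [mul_nonneg (sq_nonneg b) (by nlinarith : 0 ≤ a * b - 1)]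
  rw [div_le_div_iff₀ (by positivity) (pow_pos (by linarith) 2)]
  nlinarith
end

section
/- There exists an absolute constant C > 0 such that for every real L ≥ 2: Σ over pairs of integers k₁, k₂ ≥ 1 with k₁ + k₂ ≥ 3 of min( 1/(L²(k₁ + k₂ − 2)²) , 1/(k₁ k₂³) ) ≤ C · (log L)/L². -/
open Finset in
theorem sum_Ioc_inv_sq_le (k n : ℕ) : ∑ i ∈ Ioc k n, ((i : ℝ) ^ 2)⁻¹ ≤ 2 / (k + 1) := by
  have h : Ioc k n = Ioo k (n + 1) := by ext; simp
  rw [h]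
  exact sum_Ioo_inv_sq_le k (n + 1)

open Finset in
theorem sum_Ioc_inv_add_sq_le (a n : ℕ) :
    ∑ b ∈ Ioc 0 n, (((a : ℝ) + b) ^ 2)⁻¹ ≤ 2 / (a + 1) := by
  refine le_trans (le_of_eq ?_) (sum_Ioc_inv_sq_le a (a + n))
  have h : Ioc a (a + n) = (Ioc 0 n).map (addLeftEmbedding a) := by simp
  rw [h, sum_map]
  simp

theorem inv_mul_sqrt_le (n : ℕ) (hn : 1 ≤ n) :
    (((n + 1 : ℕ) : ℝ) * √((n + 1 : ℕ) : ℝ))⁻¹ ≤ 2 * (1 / √(n : ℝ) - 1 / √((n + 1 : ℕ) : ℝ)) := by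
  have hn' : (0 : ℝ) < n := by exact_mod_cast hn
  have hx : 0 < √(n : ℝ) := Real.sqrt_pos.2 hn'
  have hxs : √(n : ℝ) ^ 2 = n := Real.sq_sqrt hn'.le
  have hys : √((n + 1 : ℕ) : ℝ) ^ 2 = (n : ℝ) + 1 := by
    rw [Real.sq_sqrt (by positivity)]; push_cast; ring
  have hxy : √(n : ℝ) ≤ √((n + 1 : ℕ) : ℝ) := Real.sqrt_le_sqrt (by push_cast; linarith)
  have hc : ((n + 1 : ℕ) : ℝ) = √((n + 1 : ℕ) : ℝ) ^ 2 := by rw [hys]; push_cast; ring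
  generalize √((n + 1 : ℕ) : ℝ) = y at *
  generalize √(n : ℝ) = x at *
  have hy : 0 < y := hx.trans_le hxy
  have h1 : (y - x) * (y + x) = 1 := by nlinarith
  rw [hc, div_sub_div _ _ hx.ne' hy.ne', ← mul_div_assoc, inv_eq_one_div,
    div_le_div_iff₀ (by positivity) (by positivity)]
  have h2 : 1 * x ≤ 2 * (y - x) * y ^ 2 := by
    have h3 : 1 ≤ (y - x) * (2 * y) := by
      rw [← h1]; exact mul_le_mul_of_nonneg_left (by linarith) (by linarith)
    nlinarith [mul_le_mul_of_nonneg_right h3 hy.le]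
  nlinarith [mul_le_mul_of_nonneg_right h2 hy.le]

open Finset in
theorem sum_Ioc_inv_mul_sqrt_le (m n : ℕ) (hm : 1 ≤ m) :
    ∑ i ∈ Ioc m n, ((i : ℝ) * √(i : ℝ))⁻¹ ≤ 2 / √(m : ℝ) := by
  rcases le_total n m with h | h
  · rw [Ioc_eq_empty (by omega)]; simp; positivity
  have key : ∑ i ∈ Ioc m n, ((i : ℝ) * √(i : ℝ))⁻¹ ≤ 2 * (1 / √(m : ℝ) - 1 / √(n : ℝ)) := by
    induction n, h using Nat.le_induction with
    | base => simp
    | succ n hmn ih =>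
      rw [sum_Ioc_succ_top hmn]
      linarith [inv_mul_sqrt_le n (hm.trans hmn)]
  have : 0 ≤ 1 / √(n : ℝ) := by positivity
  rw [div_eq_mul_one_div]
  linarith

/-- The summand, extended to pairs of natural numbers. -/
noncomputable def pairTerm (L : ℝ) (a b : ℕ) : ℝ :=
  if 3 ≤ a + b then
    min (1 / (L ^ 2 * ((a : ℝ) + (b : ℝ) - 2) ^ 2)) (1 / ((a : ℝ) * (b : ℝ) ^ 3))
  else 0

theorem pairTerm_nonneg (L : ℝ) (a b : ℕ) : 0 ≤ pairTerm L a b := by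
  unfold pairTerm
  split_ifs <;> positivity

theorem pairTerm_le_inv_add_sq {L : ℝ} (hL : 0 < L) (a b : ℕ) :
    pairTerm L a b ≤ 9 / L ^ 2 * (((a : ℝ) + b) ^ 2)⁻¹ := by
  unfold pairTerm
  split_ifs with h
  · have h' : (3 : ℝ) ≤ a + b := by exact_mod_cast h
    have hpos : 0 < (a : ℝ) + b - 2 := by linarith
    refine (min_le_left _ _).trans ?_
    rw [← div_eq_mul_inv, div_div, div_le_div_iff₀ (by positivity) (by positivity)]
    have : ((a : ℝ) + b) ^ 2 ≤ 9 * ((a : ℝ) + b - 2) ^ 2 := by nlinarith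
    nlinarith [mul_le_mul_of_nonneg_left this (sq_nonneg L)]
  · positivity

theorem pairTerm_le_inv_sq {L : ℝ} (hL : 0 < L) {a : ℕ} (ha : 1 ≤ a) (b : ℕ) :
    pairTerm L a b ≤ 9 / L ^ 2 * ((a : ℝ) ^ 2)⁻¹ := by
  have ha' : (0 : ℝ) < a := by exact_mod_cast ha
  refine (pairTerm_le_inv_add_sq hL a b).trans ?_
  gcongr
  simp

theorem pairTerm_le_inv_mul_sqrt {L : ℝ} (hL : 0 < L) {a b : ℕ} (ha : 1 ≤ a) (hb : 1 ≤ b) :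
    pairTerm L a b ≤ 3 / L * (((a : ℝ) * √(a : ℝ))⁻¹ * ((b : ℝ) * √(b : ℝ))⁻¹) := by
  have ha' : (0 : ℝ) < a := by exact_mod_cast ha
  have hb' : (0 : ℝ) < b := by exact_mod_cast hb
  have h1 := pairTerm_le_inv_sq hL ha b
  have h2 : pairTerm L a b ≤ 1 / ((a : ℝ) * (b : ℝ) ^ 3) := by
    unfold pairTerm
    split_ifs
    · exact min_le_right _ _
    · positivity
  refine le_of_pow_le_pow_left₀ two_ne_zero (by positivity) ?_
  calc pairTerm L a b ^ 2 = pairTerm L a b * pairTerm L a b := sq _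
    _ ≤ 9 / L ^ 2 * ((a : ℝ) ^ 2)⁻¹ * (1 / ((a : ℝ) * (b : ℝ) ^ 3)) :=
      mul_le_mul h1 h2 (pairTerm_nonneg L a b) (by positivity)
    _ = _ := by
      simp only [mul_pow, inv_pow, div_pow, Real.sq_sqrt ha'.le, Real.sq_sqrt hb'.le]
      field_simp
      norm_num

open Finset in
theorem sum_pairTerm_le {L : ℝ} (hL : 2 ≤ L) (N : ℕ) (hN : ⌊L⌋₊ ≤ N) :
    ∑ a ∈ Ioc 0 N, ∑ b ∈ Ioc 0 N, pairTerm L a b ≤ 138 * Real.log L / L ^ 2 := by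
  have hL0 : 0 < L := by linarith
  set m := ⌊L⌋₊ with hm
  have hmL : (m : ℝ) ≤ L := Nat.floor_le hL0.le
  have hLm : L < m + 1 := Nat.lt_floor_add_one L
  have hm1 : 1 ≤ m := Nat.le_floor (by push_cast; linarith)
  have hm1' : (1 : ℝ) ≤ m := by exact_mod_cast hm1
  have small : ∑ a ∈ Ioc 0 m, ∑ b ∈ Ioc 0 N, pairTerm L a b ≤ 18 / L ^ 2 * (1 + Real.log L) := by
    calc ∑ a ∈ Ioc 0 m, ∑ b ∈ Ioc 0 N, pairTerm L a b
        ≤ ∑ a ∈ Ioc 0 m, 18 / L ^ 2 * (a : ℝ)⁻¹ := by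
          refine sum_le_sum fun a ha => ?_
          have ha' : (0 : ℝ) < a := by exact_mod_cast (mem_Ioc.1 ha).1
          calc ∑ b ∈ Ioc 0 N, pairTerm L a b
              ≤ ∑ b ∈ Ioc 0 N, 9 / L ^ 2 * (((a : ℝ) + b) ^ 2)⁻¹ :=
                sum_le_sum fun b _ => pairTerm_le_inv_add_sq hL0 a b
            _ ≤ 9 / L ^ 2 * (2 / (a + 1)) := by
                rw [← mul_sum]
                gcongr
                exact sum_Ioc_inv_add_sq_le a N
            _ ≤ 9 / L ^ 2 * (2 / a) := by gcongr; linarith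
            _ = _ := by ring
      _ ≤ 18 / L ^ 2 * (1 + Real.log L) := by
          rw [← mul_sum]
          gcongr
          have h := harmonic_floor_le_one_add_log L (by linarith)
          rw [harmonic_eq_sum_Icc] at h
          push_cast at h
          exact h
  have mixed : ∑ a ∈ Ioc m N, ∑ b ∈ Ioc 0 m, pairTerm L a b ≤ 18 / L ^ 2 := by
    calc ∑ a ∈ Ioc m N, ∑ b ∈ Ioc 0 m, pairTerm L a b
        ≤ ∑ a ∈ Ioc m N, ∑ b ∈ Ioc 0 m, 9 / L ^ 2 * ((a : ℝ) ^ 2)⁻¹ :=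
          sum_le_sum fun a ha => sum_le_sum fun b _ =>
            pairTerm_le_inv_sq hL0 (by have := mem_Ioc.1 ha; omega) b
      _ = m * (9 / L ^ 2) * ∑ a ∈ Ioc m N, ((a : ℝ) ^ 2)⁻¹ := by
          simp [mul_sum, mul_assoc]
      _ ≤ L * (9 / L ^ 2) * (2 / L) := by
          gcongr
          exact (sum_Ioc_inv_sq_le m N).trans (by gcongr)
      _ = 18 / L ^ 2 := by field_simp; norm_num
  have large : ∑ a ∈ Ioc m N, ∑ b ∈ Ioc m N, pairTerm L a b ≤ 24 / L ^ 2 := by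
    calc ∑ a ∈ Ioc m N, ∑ b ∈ Ioc m N, pairTerm L a b
        ≤ ∑ a ∈ Ioc m N, ∑ b ∈ Ioc m N,
            3 / L * (((a : ℝ) * √(a : ℝ))⁻¹ * ((b : ℝ) * √(b : ℝ))⁻¹) :=
          sum_le_sum fun a ha => sum_le_sum fun b hb =>
            pairTerm_le_inv_mul_sqrt hL0 (by have := mem_Ioc.1 ha; omega)
              (by have := mem_Ioc.1 hb; omega)
      _ = 3 / L * ((∑ a ∈ Ioc m N, ((a : ℝ) * √(a : ℝ))⁻¹) *
            ∑ b ∈ Ioc m N, ((b : ℝ) * √(b : ℝ))⁻¹) := by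
          simp_rw [sum_mul_sum, mul_sum]
      _ ≤ 3 / L * (2 / √(m : ℝ) * (2 / √(m : ℝ))) := by
          gcongr <;> exact sum_Ioc_inv_mul_sqrt_le m N hm1
      _ = 12 / (L * m) := by
          rw [div_mul_div_comm, Real.mul_self_sqrt (by positivity), div_mul_div_comm]
          norm_num
      _ ≤ 24 / L ^ 2 := by
          rw [div_le_div_iff₀ (by positivity) (by positivity)]
          nlinarith
  have split : ∑ a ∈ Ioc 0 N, ∑ b ∈ Ioc 0 N, pairTerm L a b =
      ∑ a ∈ Ioc 0 m, ∑ b ∈ Ioc 0 N, pairTerm L a b +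
      (∑ a ∈ Ioc m N, ∑ b ∈ Ioc 0 m, pairTerm L a b +
       ∑ a ∈ Ioc m N, ∑ b ∈ Ioc m N, pairTerm L a b) := by
    rw [← sum_add_distrib, ← sum_Ioc_consecutive _ (Nat.zero_le m) hN]
    congr 1
    exact sum_congr rfl fun a _ => (sum_Ioc_consecutive _ (Nat.zero_le m) hN).symm
  have hlog : 1 / 2 ≤ Real.log L :=
    (by linarith [Real.log_two_gt_d9] : 1 / 2 ≤ Real.log 2).trans
      (Real.log_le_log (by norm_num) hL)
  calc _ ≤ 18 / L ^ 2 * (1 + Real.log L) + (18 / L ^ 2 + 24 / L ^ 2) := by rw [split]; gcongr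
    _ = (60 + 18 * Real.log L) / L ^ 2 := by ring
    _ ≤ 138 * Real.log L / L ^ 2 := by gcongr; linarith

/-- There is an absolute constant `C > 0` such that for all real `L ≥ 2`,
`Σ_{k₁,k₂ ≥ 1, k₁+k₂ ≥ 3} min(1/(L²(k₁+k₂−2)²), 1/(k₁k₂³)) ≤ C (log L)/L²`. -/
theorem stmt_6 :
    ∃ C : ℝ, 0 < C ∧
      ∀ L : ℝ, 2 ≤ L →
        (∑' (k : ℕ+ × ℕ+),
            if 3 ≤ (k.1 : ℕ) + (k.2 : ℕ) then
              min (1 / (L ^ 2 * (((k.1 : ℕ) : ℝ) + ((k.2 : ℕ) : ℝ) - 2) ^ 2))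
                (1 / (((k.1 : ℕ) : ℝ) * ((k.2 : ℕ) : ℝ) ^ 3))
            else 0)
          ≤ C * Real.log L / L ^ 2 := by
  refine ⟨138, by norm_num, fun L hL => ?_⟩
  change ∑' k : ℕ+ × ℕ+, pairTerm L k.1 k.2 ≤ _
  refine Real.tsum_le_of_sum_le (fun k => pairTerm_nonneg L _ _) fun T => ?_
  set N := T.sup (fun k => max (k.1 : ℕ) (k.2 : ℕ)) + ⌊L⌋₊ with hN
  refine le_trans ?_ (sum_pairTerm_le hL N (Nat.le_add_left _ _))
  have hinj : Function.Injective (fun k : ℕ+ × ℕ+ => ((k.1 : ℕ), (k.2 : ℕ))) := by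
    rintro ⟨a, b⟩ ⟨c, d⟩ h
    simpa using h
  rw [← Finset.sum_product', ← Finset.sum_image (s := T) (f := fun k => pairTerm L k.1 k.2)
    (fun _ _ _ _ h => hinj h)]
  refine Finset.sum_le_sum_of_subset_of_nonneg ?_ fun k _ _ => pairTerm_nonneg L _ _
  refine Finset.image_subset_iff.2 fun k hk => ?_
  have h := Finset.le_sup (f := fun k : ℕ+ × ℕ+ => max (k.1 : ℕ) (k.2 : ℕ)) hk
  have h1 := k.1.pos
  have h2 := k.2.pos
  simp only [Finset.mem_product, Finset.mem_Ioc]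
  omega
end

section
/- Let C₀ > 0 and M > 0, let g : ℝ → ℝ be an even measurable function with |g| ≤ M and g(x) = 0 for |x| > C₀, let ω : ℝ → ℝ be a nonnegative, even, integrable function with ∫_ℝ ω(t) dt = 1, ŵ(ξ) := ∫_ℝ ω(t) cos(tξ) dt, U_T(x,y) := (1/2)ŵ(T(x−y)) + (1/2)ŵ(T(x+y)) − ŵ(Tx)·ŵ(Ty), and H_L(x) := x·g(x/L)/sinh(x/2). Then there is a constant C > 0, depending only on C₀ and M, such that for all T > 0 and L ≥ 2: Σ over pairs of integers k₁, k₂ ≥ 1 with k₁ + k₂ ≥ 3 of (4/L²)·(1/(k₁k₂)) ∫₀^∞ |H_L(k₁x)| · |H_L(k₂x)| · |U_T(k₁x, k₂x)| · (2 sinh²(x/2)/x) dx ≤ C · (log L)/L². -/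
open MeasureTheory

namespace Real

lemma natCast_mul_sinh_le {y : ℝ} (hy : 0 ≤ y) (k : ℕ) : k * sinh y ≤ sinh (k * y) := by
  induction k with
  | zero => simp
  | succ k ih =>
    have hs : 0 ≤ sinh (k * y) := sinh_nonneg_iff.2 (by positivity)
    have hs' : 0 ≤ sinh y := sinh_nonneg_iff.2 hy
    have h₁ := mul_nonneg hs (sub_nonneg.2 (one_le_cosh y))
    have h₂ := mul_nonneg hs' (sub_nonneg.2 (one_le_cosh (k * y)))
    push_cast
    rw [add_mul, add_mul, one_mul, one_mul, sinh_add]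
    linarith

lemma exp_mul_sinh_le (y : ℝ) {z : ℝ} (hz : 0 ≤ z) : exp z * sinh y ≤ sinh (z + y) := by
  have h₁ : 0 ≤ sinh z * exp (-y) := mul_nonneg (sinh_nonneg_iff.2 hz) (exp_pos _).le
  rw [← cosh_sub_sinh] at h₁
  rw [sinh_add, ← cosh_add_sinh]
  linarith

lemma sqrt_mul_exp_mul_sinh_le {y : ℝ} (hy : 0 ≤ y) {k : ℕ} (hk : 1 ≤ k) :
    √k * exp ((k - 1) * y / 2) * sinh y ≤ sinh (k * y) := by
  have hk' : (1 : ℝ) ≤ k := by exact_mod_cast hk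
  have hs : 0 ≤ sinh y := sinh_nonneg_iff.2 hy
  have hs' : 0 ≤ sinh (k * y) := sinh_nonneg_iff.2 (by positivity)
  have h₁ := natCast_mul_sinh_le hy k
  have h₂ := exp_mul_sinh_le y (mul_nonneg (sub_nonneg.2 hk') hy)
  rw [show ((k : ℝ) - 1) * y + y = k * y by ring] at h₂
  refine (pow_le_pow_iff_left₀ (by positivity) hs' two_ne_zero).1 ?_
  calc (√k * exp ((k - 1) * y / 2) * sinh y) ^ 2
      = (√k) ^ 2 * exp ((k - 1) * y / 2) ^ 2 * sinh y ^ 2 := by ring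
    _ = (k * sinh y) * (exp ((k - 1) * y) * sinh y) := by
        rw [sq_sqrt (by positivity), ← exp_nat_mul]
        push_cast
        rw [mul_div_cancel₀ _ (two_ne_zero' ℝ)]
        ring
    _ ≤ sinh (k * y) * sinh (k * y) := mul_le_mul h₁ h₂ (by positivity) hs'
    _ = _ := by ring

lemma integral_mul_exp_neg_mul_Ioi {r : ℝ} (hr : 0 < r) :
    ∫ x in Set.Ioi (0 : ℝ), x * exp (-(r * x)) = 1 / r ^ 2 := by
  have h := integral_rpow_mul_exp_neg_mul_Ioi (a := 2) two_pos hr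
  norm_num [Gamma_two] at h
  simpa using h

lemma integrableOn_mul_exp_neg_mul_Ioi {r : ℝ} (hr : 0 < r) :
    IntegrableOn (fun x => x * exp (-(r * x))) (Set.Ioi 0) := by
  by_contra h
  have := integral_mul_exp_neg_mul_Ioi hr
  rw [integral_undef h] at this
  have : 0 < 1 / r ^ 2 := by positivity
  linarith

lemma abs_mul_div_sinh_le {M x b : ℝ} (hx : 0 < x) (hb : |b| ≤ M) {k : ℕ} (hk : 1 ≤ k) :
    |k * x * b / sinh (k * x / 2)| ≤ M * √k * x * exp (-((k - 1) / 4 * x)) / sinh (x / 2) := by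
  have hk' : (0 : ℝ) < k := by exact_mod_cast hk
  have hM : 0 ≤ M := (abs_nonneg b).trans hb
  have hs : 0 < sinh (x / 2) := sinh_pos_iff.2 (by positivity)
  have hs' : 0 < sinh (k * x / 2) := sinh_pos_iff.2 (by positivity)
  have h := sqrt_mul_exp_mul_sinh_le (half_pos hx).le hk
  rw [show (k : ℝ) * (x / 2) = k * x / 2 by ring,
    show ((k : ℝ) - 1) * (x / 2) / 2 = (k - 1) / 4 * x by ring] at h
  rw [abs_div, abs_mul, abs_of_pos hs', abs_of_pos (mul_pos hk' hx)]
  calc k * x * |b| / sinh (k * x / 2)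
      ≤ k * x * M / (√k * exp ((k - 1) / 4 * x) * sinh (x / 2)) := by gcongr
    _ = M * √k * x * exp (-((k - 1) / 4 * x)) / sinh (x / 2) := by
        rw [exp_neg]
        have : √(k : ℝ) ≠ 0 := by positivity
        field_simp
        rw [sq_sqrt hk'.le, mul_comm]

end Real

lemma abs_integral_mul_cos_le_one {ω : ℝ → ℝ} (hω : ∀ t, 0 ≤ ω t) (hi : Integrable ω)
    (h1 : ∫ t, ω t = 1) (ξ : ℝ) : |∫ t, ω t * Real.cos (t * ξ)| ≤ 1 := by
  rw [← h1, ← Real.norm_eq_abs]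
  refine norm_integral_le_of_norm_le hi (.of_forall fun t => ?_)
  rw [Real.norm_eq_abs, abs_mul, abs_of_nonneg (hω t)]
  exact mul_le_of_le_one_right (hω t) (Real.abs_cos_le_one _)

lemma abs_half_add_half_sub_mul_le_two {a b c d : ℝ} (ha : |a| ≤ 1) (hb : |b| ≤ 1) (hc : |c| ≤ 1)
    (hd : |d| ≤ 1) : |1 / 2 * a + 1 / 2 * b - c * d| ≤ 2 := by
  have hcd : |c * d| ≤ 1 := by
    rw [abs_mul]
    exact mul_le_one₀ hc (abs_nonneg d) hd
  rw [abs_le] at *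
  constructor <;> linarith

/-- Bound for one pair `(m, n) ≠ (1, 1)`, with `φ` in the role of `|U_T(mx, nx)|`. -/
lemma integral_sinh_pair_le {M : ℝ} {g φ : ℝ → ℝ} (hg : ∀ x, |g x| ≤ M) (hφ₀ : ∀ x, 0 ≤ φ x)
    (hφ : ∀ x, φ x ≤ 2) (L : ℝ) {m n : ℕ} (hm : 1 ≤ m) (hn : 1 ≤ n) (hmn : 3 ≤ m + n) :
    ∫ x in Set.Ioi (0 : ℝ), |m * x * g (m * x / L) / Real.sinh (m * x / 2)| *
        |n * x * g (n * x / L) / Real.sinh (n * x / 2)| * φ x * (2 * Real.sinh (x / 2) ^ 2 / x)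
      ≤ 144 * M ^ 2 * (√m * √n) / (m * n) := by
  have hm' : (1 : ℝ) ≤ m := by exact_mod_cast hm
  have hn' : (1 : ℝ) ≤ n := by exact_mod_cast hn
  have hmn' : (3 : ℝ) ≤ m + n := by exact_mod_cast hmn
  have hM : 0 ≤ M := (abs_nonneg _).trans (hg 0)
  set r : ℝ := (m + n - 2) / 4 with hr
  have hr₀ : 0 < r := by rw [hr]; linarith
  have hle : 1 / r ^ 2 ≤ 36 / (m * n) := by
    rw [div_le_div_iff₀ (by positivity) (by positivity)]
    have h₁ : ((m : ℝ) + n) / 12 ≤ r := by rw [hr]; linarith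
    have h₂ := pow_le_pow_left₀ (by positivity) h₁ 2
    nlinarith [sq_nonneg ((m : ℝ) - n)]
  calc _ ≤ ∫ x in Set.Ioi (0 : ℝ), 4 * M ^ 2 * (√m * √n) * (x * Real.exp (-(r * x))) := by
        refine integral_mono_of_nonneg ?_
          ((Real.integrableOn_mul_exp_neg_mul_Ioi hr₀).const_mul _) ?_
        · filter_upwards [self_mem_ae_restrict measurableSet_Ioi] with x hx
          have hx : 0 < x := hx
          have := hφ₀ x
          positivity
        · filter_upwards [self_mem_ae_restrict measurableSet_Ioi] with x hx
          have hx : 0 < x := hx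
          have hs : 0 < Real.sinh (x / 2) := Real.sinh_pos_iff.2 (by positivity)
          have h₁ := Real.abs_mul_div_sinh_le hx (hg (m * x / L)) hm
          have h₂ := Real.abs_mul_div_sinh_le hx (hg (n * x / L)) hn
          calc _ ≤ (M * √m * x * Real.exp (-((m - 1) / 4 * x)) / Real.sinh (x / 2)) *
                (M * √n * x * Real.exp (-((n - 1) / 4 * x)) / Real.sinh (x / 2)) * 2 *
                (2 * Real.sinh (x / 2) ^ 2 / x) := by
                gcongr
                · exact hφ₀ x
                · exact hφ x
            _ = 4 * M ^ 2 * (√m * √n) * (x * (Real.exp (-((m - 1) / 4 * x)) *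
                Real.exp (-((n - 1) / 4 * x)))) := by
                field_simp
                ring
            _ = _ := by
                rw [← Real.exp_add, hr]
                ring_nf
    _ = 4 * M ^ 2 * (√m * √n) * (1 / r ^ 2) := by
        rw [integral_const_mul, Real.integral_mul_exp_neg_mul_Ioi hr₀]
    _ ≤ 4 * M ^ 2 * (√m * √n) * (36 / (m * n)) := by gcongr
    _ = _ := by ring

lemma summable_pnat_sqrt_div_sq : Summable fun k : ℕ+ => √(k : ℕ) / ((k : ℕ) : ℝ) ^ 2 := by
  have h : Summable fun k : ℕ => (k : ℝ) ^ (-(3 / 2) : ℝ) :=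
    Real.summable_nat_rpow.2 (by norm_num)
  refine (h.comp_injective PNat.coe_injective).congr fun k => ?_
  have hk : (0 : ℝ) < (k : ℕ) := by exact_mod_cast k.pos
  rw [Function.comp_apply, Real.sqrt_eq_rpow, ← Real.rpow_natCast, ← Real.rpow_sub hk]
  norm_num

lemma tsum_le_tsum_of_nonneg_of_summable {ι : Type*} {f g : ι → ℝ} (hf : ∀ i, 0 ≤ f i)
    (hfg : ∀ i, f i ≤ g i) (hg : Summable g) : ∑' i, f i ≤ ∑' i, g i :=
  (hg.of_nonneg_of_le hf hfg).tsum_le_tsum hfg hg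

/-- diagonal contribution of pairs with `k₁ + k₂ ≥ 3`. There is `C > 0`
depending only on `C₀, M` such that, with `H_L(x) = x g(x/L)/sinh(x/2)` and
`U_T(x,y) = (1/2)w(T(x−y)) + (1/2)w(T(x+y)) − w(Tx)w(Ty)`, for all `T > 0` and `L ≥ 2`:
`Σ_{k₁+k₂ ≥ 3} (4/L²)(1/(k₁k₂)) ∫₀^∞ |H_L(k₁x)||H_L(k₂x)||U_T(k₁x,k₂x)|
 (2 sinh²(x/2)/x) dx ≤ C (log L)/L²`. -/
theorem stmt_7 (C₀ M : ℝ) (hC₀ : 0 < C₀) (hM : 0 < M) :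
    ∃ C : ℝ, 0 < C ∧
      ∀ (g ω w : ℝ → ℝ),
        Measurable g → (∀ x, g (-x) = g x) → (∀ x, |g x| ≤ M) →
        (∀ x, C₀ < |x| → g x = 0) →
        (∀ t, 0 ≤ ω t) → (∀ t, ω (-t) = ω t) → Integrable ω → (∫ t : ℝ, ω t = 1) →
        (∀ ξ : ℝ, w ξ = ∫ t : ℝ, ω t * Real.cos (t * ξ)) →
        ∀ (U : ℝ → ℝ → ℝ → ℝ),
          (∀ T x y : ℝ, U T x y =
            (1 / 2) * w (T * (x - y)) + (1 / 2) * w (T * (x + y)) - w (T * x) * w (T * y)) →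
        ∀ (H : ℝ → ℝ → ℝ),
          (∀ L x : ℝ, H L x = x * g (x / L) / Real.sinh (x / 2)) →
        ∀ (T L : ℝ), 0 < T → 2 ≤ L →
        (∑' (k : ℕ+ × ℕ+),
            if 3 ≤ (k.1 : ℕ) + (k.2 : ℕ) then
              (4 / L ^ 2) * (1 / (((k.1 : ℕ) : ℝ) * ((k.2 : ℕ) : ℝ))) *
                ∫ x in Set.Ioi (0 : ℝ),
                  |H L (((k.1 : ℕ) : ℝ) * x)| * |H L (((k.2 : ℕ) : ℝ) * x)| *
                    |U T (((k.1 : ℕ) : ℝ) * x) (((k.2 : ℕ) : ℝ) * x)| *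
                    (2 * Real.sinh (x / 2) ^ 2 / x)
            else 0)
          ≤ C * Real.log L / L ^ 2 := by
  set a : ℕ+ × ℕ+ → ℝ := fun k => √(k.1 : ℕ) / ((k.1 : ℕ) : ℝ) ^ 2 *
    (√(k.2 : ℕ) / ((k.2 : ℕ) : ℝ) ^ 2) with ha
  have ha₀ : ∀ k, 0 ≤ a k := fun k => by rw [ha]; positivity
  have hsum : Summable a := summable_pnat_sqrt_div_sq.mul_of_nonneg summable_pnat_sqrt_div_sq
    (fun k => by positivity) (fun k => by positivity)
  have hS : 0 ≤ ∑' k, a k := tsum_nonneg ha₀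
  have hlog : 0 < Real.log 2 := Real.log_pos one_lt_two
  refine ⟨576 * M ^ 2 * (∑' k, a k) / Real.log 2 + 1, by positivity, ?_⟩
  intro g ω w _ _ hg _ hω _ hi h1 hw U hU H hH T L _ hL
  have hw1 : ∀ ξ, |w ξ| ≤ 1 := fun ξ => by
    rw [hw]
    exact abs_integral_mul_cos_le_one hω hi h1 ξ
  have hU2 : ∀ x y, |U T x y| ≤ 2 := fun x y => by
    rw [hU]
    exact abs_half_add_half_sub_mul_le_two (hw1 _) (hw1 _) (hw1 _) (hw1 _)
  simp only [hH]
  have hlogL : Real.log 2 ≤ Real.log L := Real.log_le_log two_pos hL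
  have hterm := (hsum.mul_left (576 * M ^ 2 / L ^ 2))
  calc _ ≤ ∑' k, 576 * M ^ 2 / L ^ 2 * a k := by
        refine tsum_le_tsum_of_nonneg_of_summable ?_ ?_ hterm
        · intro k
          split_ifs with h
          · refine mul_nonneg (by positivity) (setIntegral_nonneg measurableSet_Ioi fun x hx => ?_)
            have hx : 0 < x := hx
            positivity
          · exact le_rfl
        · intro k
          have hk₁ : (0 : ℝ) < (k.1 : ℕ) := by exact_mod_cast k.1.pos
          have hk₂ : (0 : ℝ) < (k.2 : ℕ) := by exact_mod_cast k.2.pos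
          split_ifs with h
          · refine (mul_le_mul_of_nonneg_left (integral_sinh_pair_le hg
              (fun x => abs_nonneg (U T (((k.1 : ℕ) : ℝ) * x) (((k.2 : ℕ) : ℝ) * x)))
              (fun x => hU2 _ _) L k.1.pos k.2.pos h) (by positivity)).trans_eq ?_
            simp only [ha]
            field_simp
            norm_num
          · exact mul_nonneg (by positivity) (ha₀ k)
    _ = 576 * M ^ 2 * (∑' k, a k) / Real.log 2 * Real.log 2 / L ^ 2 := by
        rw [tsum_mul_left]
        field_simp
    _ ≤ (576 * M ^ 2 * (∑' k, a k) / Real.log 2 + 1) * Real.log L / L ^ 2 := by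
        gcongr
        linarith
end

section
/- Let C₀ > 0 and M > 0, let g : ℝ → ℝ be an even continuous function with |g| ≤ M and g(x) = 0 for |x| > C₀, and let ω : ℝ → ℝ be a nonnegative, even, integrable function with ∫_ℝ ω(t) dt = 1 whose cosine transform ŵ(ξ) := ∫_ℝ ω(t) cos(tξ) dt vanishes outside [−1,1]. Then there is a constant C > 0, depending only on C₀ and M, such that for all T ≥ 1 and L ≥ 1: | (8/L²) ∫₀^∞ x · g(x/L)² · ( 1/2 + (1/2)ŵ(2Tx) − ŵ(Tx)² ) dx − 2∫_ℝ |y| g(y)² dy | ≤ C/(TL). -/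
open MeasureTheory

lemma continuous_cosTransform {ω : ℝ → ℝ} (hω : Integrable ω) :
    Continuous fun ξ : ℝ => ∫ t : ℝ, ω t * Real.cos (t * ξ) := by
  refine continuous_of_dominated (bound := fun t => ‖ω t‖) (fun ξ => ?_) (fun ξ => ?_) hω.norm ?_
  · exact hω.aestronglyMeasurable.mul (by fun_prop)
  · refine Filter.Eventually.of_forall fun t => ?_
    rw [norm_mul]
    exact mul_le_of_le_one_right (norm_nonneg _) (Real.abs_cos_le_one _)
  · exact Filter.Eventually.of_forall fun t => by fun_prop

lemma abs_cosTransform_le {ω : ℝ → ℝ} (hω : Integrable ω) (h0 : ∀ t, 0 ≤ ω t) (ξ : ℝ) :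
    |∫ t : ℝ, ω t * Real.cos (t * ξ)| ≤ ∫ t : ℝ, ω t := by
  refine norm_integral_le_of_norm_le (f := fun t => ω t * Real.cos (t * ξ)) hω
    (Filter.Eventually.of_forall fun t => ?_)
  rw [norm_mul, Real.norm_of_nonneg (h0 t)]
  exact mul_le_of_le_one_right (h0 t) (Real.abs_cos_le_one _)

lemma integral_abs_mul_sq_of_even {g : ℝ → ℝ} (hg : ∀ x, g (-x) = g x) :
    ∫ y : ℝ, |y| * g y ^ 2 = 2 * ∫ y in Set.Ioi (0 : ℝ), y * g y ^ 2 := by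
  rw [← integral_comp_abs (f := fun y => y * g y ^ 2)]
  congr 1 with y
  rcases abs_choice y with h | h <;> simp only [h, hg]

lemma integral_Ioi_mul_comp_div_sq (g : ℝ → ℝ) {L : ℝ} (hL : 0 < L) :
    ∫ x in Set.Ioi (0 : ℝ), x * g (x / L) ^ 2
      = L ^ 2 * ∫ y in Set.Ioi (0 : ℝ), y * g y ^ 2 := by
  have h := integral_comp_mul_left_Ioi (fun y => y * g y ^ 2) 0 (inv_pos.2 hL)
  simp only [mul_zero, inv_inv, smul_eq_mul] at h
  rw [pow_two, mul_assoc, ← h, ← integral_const_mul]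
  congr 1 with x
  rw [← mul_assoc, ← mul_assoc, mul_inv_cancel₀ hL.ne', one_mul, inv_mul_eq_div]

lemma abs_integral_remainder_le {M T L : ℝ} {g w : ℝ → ℝ} (hgM : ∀ x, |g x| ≤ M)
    (hw1 : ∀ ξ, |w ξ| ≤ 1) (hw0 : ∀ ξ : ℝ, 1 < |ξ| → w ξ = 0) (hT : 0 < T) :
    |∫ x in Set.Ioi (0 : ℝ), x * g (x / L) ^ 2 * ((1 / 2) * w (2 * T * x) - w (T * x) ^ 2)|
      ≤ 3 / 2 * M ^ 2 / T ^ 2 := by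
  rw [setIntegral_eq_of_subset_of_forall_sdiff_eq_zero (s := Set.Ioc 0 (1 / T))
    measurableSet_Ioi Set.Ioc_subset_Ioi_self]
  · have hb := norm_setIntegral_le_of_norm_le_const (μ := volume) (s := Set.Ioc 0 (1 / T))
      (f := fun x => x * g (x / L) ^ 2 * ((1 / 2) * w (2 * T * x) - w (T * x) ^ 2))
      (C := 1 / T * M ^ 2 * (3 / 2)) (by simp) ?_
    · rw [Real.volume_real_Ioc_of_le (by positivity)] at hb
      refine hb.trans_eq ?_
      field_simp
      ring
    · rintro x ⟨hx0, hx1⟩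
      have h1 := abs_le.1 (hw1 (2 * T * x))
      have h2 : w (T * x) ^ 2 ≤ 1 := (sq_le_one_iff_abs_le_one _).2 (hw1 _)
      have h3 : g (x / L) ^ 2 ≤ M ^ 2 := sq_le_sq' (abs_le.1 (hgM _)).1 (abs_le.1 (hgM _)).2
      rw [Real.norm_eq_abs, abs_mul, abs_mul, abs_of_pos hx0, abs_of_nonneg (sq_nonneg (g _))]
      gcongr
      rw [abs_le]
      constructor <;> nlinarith [sq_nonneg (w (T * x))]
  · rintro x ⟨hx0, hx1⟩
    have hx0 : 0 < x := hx0
    have hx : 1 < T * x := by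
      by_contra! h
      exact hx1 ⟨hx0, by rwa [le_div_iff₀' hT]⟩
    rw [hw0 (T * x) (hx.trans_le (le_abs_self _)),
      hw0 (2 * T * x) (lt_of_lt_of_le (by linarith) (le_abs_self _))]
    simp

/-- the `(k₁,k₂)=(1,1)` diagonal Poisson expectation equals the GOE variance
up to `O(1/(TL))`. There is `C > 0` depending only on `C₀, M` such that for all
`T ≥ 1`, `L ≥ 1`:
`|(8/L²)∫₀^∞ x g(x/L)² (1/2 + (1/2)w(2Tx) − w(Tx)²) dx − 2∫_ℝ |y| g(y)² dy| ≤ C/(TL)`. -/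
theorem stmt_8 (C₀ M : ℝ) (hC₀ : 0 < C₀) (hM : 0 < M) :
    ∃ C : ℝ, 0 < C ∧
      ∀ (g ω w : ℝ → ℝ),
        Continuous g → (∀ x, g (-x) = g x) → (∀ x, |g x| ≤ M) →
        (∀ x, C₀ < |x| → g x = 0) →
        (∀ t, 0 ≤ ω t) → (∀ t, ω (-t) = ω t) → Integrable ω → (∫ t : ℝ, ω t = 1) →
        (∀ ξ : ℝ, w ξ = ∫ t : ℝ, ω t * Real.cos (t * ξ)) →
        (∀ ξ : ℝ, 1 < |ξ| → w ξ = 0) →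
        ∀ (T L : ℝ), 1 ≤ T → 1 ≤ L →
        |(8 / L ^ 2) * (∫ x in Set.Ioi (0 : ℝ),
              x * g (x / L) ^ 2 * (1 / 2 + (1 / 2) * w (2 * T * x) - w (T * x) ^ 2))
            - 2 * ∫ y : ℝ, |y| * g y ^ 2|
          ≤ C / (T * L) := by
  refine ⟨12 * M ^ 2, by positivity, ?_⟩
  intro g ω w hg hge hgM hg0 hω0 _ hω hω1 hw hw0 T L hT hL
  have hT0 : 0 < T := by linarith
  have hL0 : 0 < L := by linarith
  have hwc : Continuous w := by
    rw [funext hw]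
    exact continuous_cosTransform hω
  have hw1 : ∀ ξ, |w ξ| ≤ 1 := fun ξ => by
    rw [hw, ← hω1]
    exact abs_cosTransform_le hω hω0 ξ
  have hint : ∀ k : ℝ → ℝ, Continuous k → Integrable fun x => x * g (x / L) ^ 2 * k x := by
    intro k hk
    refine Continuous.integrable_of_hasCompactSupport (by fun_prop) ?_
    refine HasCompactSupport.intro (isCompact_Icc (a := -(C₀ * L)) (b := C₀ * L)) fun x hx => ?_
    rw [hg0 (x / L)]
    · simp
    · rw [abs_div, abs_of_pos hL0, lt_div_iff₀ hL0]
      by_contra! h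
      exact hx (abs_le.1 h)
  have hsplit : ∫ x in Set.Ioi (0 : ℝ),
        x * g (x / L) ^ 2 * (1 / 2 + (1 / 2) * w (2 * T * x) - w (T * x) ^ 2)
      = (∫ x in Set.Ioi (0 : ℝ), x * g (x / L) ^ 2) * (1 / 2)
        + ∫ x in Set.Ioi (0 : ℝ),
            x * g (x / L) ^ 2 * ((1 / 2) * w (2 * T * x) - w (T * x) ^ 2) := by
    rw [← integral_mul_const, ← integral_add (hint _ continuous_const).integrableOn
      (hint _ (by fun_prop)).integrableOn]
    congr 1 with x
    ring
  have hR := abs_integral_remainder_le (L := L) hgM hw1 hw0 hT0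
  rw [hsplit, integral_Ioi_mul_comp_div_sq g hL0, integral_abs_mul_sq_of_even hge]
  generalize (∫ x in Set.Ioi (0 : ℝ),
    x * g (x / L) ^ 2 * ((1 / 2) * w (2 * T * x) - w (T * x) ^ 2)) = R at hR ⊢
  generalize (∫ y in Set.Ioi (0 : ℝ), y * g y ^ 2) = I
  have hmain : 8 / L ^ 2 * (L ^ 2 * I * (1 / 2) + R) - 2 * (2 * I) = 8 / L ^ 2 * R := by
    field_simp
    ring
  rw [hmain, abs_mul, abs_of_pos (by positivity)]
  calc 8 / L ^ 2 * |R| ≤ 8 / L ^ 2 * (3 / 2 * M ^ 2 / T ^ 2) := by gcongr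
    _ = 12 * M ^ 2 / (T ^ 2 * L ^ 2) := by
      field_simp
      norm_num
    _ ≤ 12 * M ^ 2 / (T * L) := by
      gcongr
      · exact le_self_pow₀ hT two_ne_zero
      · exact le_self_pow₀ hL two_ne_zero
end
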